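/- There exists an absolute constant C ≥ 2 such that the following holds. Let L_1, …, L_N be independent copies of the random λ-transform Z_λ (Z_λ(x) = H_ε^{-1} Q_λ(H_ε x) with ε uniform on {−1,1}^d and dither uniform on [−λ,λ]^d, all independent across copies). For B > 0 and α ≥ C, set λ = α·B·√(log d / d). Then for any vectors x_1, …, x_N ∈ ℝ^d with max_n ‖x_n‖ ≤ B: E[‖(1/N)Σ_{n=1}^N L_n(x_n) − (1/N)Σ_{n=1}^N x_n‖²] ≤ (1/N²)·Σ_{n=1}^N E[‖L_n(x_n) − x_n‖²] + 8·N·B²·exp(−(1/8)·α²·log d), where ‖·‖ is the Euclidean norm. -/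

import Mathlib

open MeasureTheory Matrix
open scoped NNReal

/-- Sign convention: `sgn s = 1` if `s ≥ 0`, `sgn s = -1` if `s < 0`. -/
noncomputable def sgn (s : ℝ) : ℝ := if 0 ≤ s then 1 else -1

/-- The uniform probability measure on the interval `[-lam, lam]`. -/
noncomputable def unifIcc (lam : ℝ) : Measure ℝ :=
  ((Real.toNNReal (2 * lam))⁻¹ : ℝ≥0) • volume.restrict (Set.Icc (-lam) lam)

instance (lam : ℝ) : IsFiniteMeasure (unifIcc lam) := by
  unfold unifIcc; infer_instance

/-- The uniform probability measure on sign patterns `{−1,1}^d`, encoded via `Fin d → Bool`. -/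
noncomputable def radMeasure (d : ℕ) : Measure (Fin d → Bool) :=
  (PMF.uniformOfFintype (Fin d → Bool)).toMeasure

instance (d : ℕ) : IsProbabilityMeasure (radMeasure d) := by
  unfold radMeasure; infer_instance

/-- The `±1` vector associated to a sign pattern. -/
noncomputable def radVec {d : ℕ} (b : Fin d → Bool) : Fin d → ℝ :=
  fun i => if b i then 1 else -1

/-- The `λ`-transform `Z_λ(x) = H_ε⁻¹ Q_λ(H_ε x)` with `H_ε = H·D_ε` and
`H_ε⁻¹ = D_ε·Hᵀ`, given a realization `b` of `ε` and `τ` of the dither: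
`Z_λ(x) i = ε i · Σ_j H j i · (λ · sign((H_ε x) j + τ j))`. -/
noncomputable def Ltrans {d : ℕ} (H : Matrix (Fin d) (Fin d) ℝ) (b : Fin d → Bool)
    (lam : ℝ) (τ : Fin d → ℝ) (x : Fin d → ℝ) : Fin d → ℝ :=
  fun i => radVec b i * ∑ j : Fin d, H j i *
    (lam * sgn ((∑ l : Fin d, H j l * (radVec b l * x l)) + τ j))

section AuxLemmas

open ProbabilityTheory

lemma aux_sum {Ω : Type*} [MeasurableSpace Ω] {N : ℕ} (ν : Measure Ω) [IsProbabilityMeasure ν]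
    (f : Fin N → Ω → ℝ) (hf : ∀ n, MemLp (f n) 2 ν) :
    ∫ ω, (∑ n, f n (ω n)) ^ 2 ∂(Measure.pi fun _ : Fin N => ν) ≤
      ∑ n, ∫ ω, (f n (ω n)) ^ 2 ∂(Measure.pi fun _ : Fin N => ν) +
        N * ∑ n, (∫ p, f n p ∂ν) ^ 2 := by
  set μ := Measure.pi fun _ : Fin N => ν
  have hX : ∀ n, MemLp (fun ω : Fin N → Ω => f n (ω n)) 2 μ := fun n =>
    (hf n).comp_measurePreserving (measurePreserving_eval _ n)
  have hind : iIndepFun (fun n (ω : Fin N → Ω) => f n (ω n)) μ :=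
    iIndepFun_pi (fun n => (hf n).1.aemeasurable)
  have hE : ∀ n, ∫ ω, f n (ω n) ∂μ = ∫ p, f n p ∂ν := fun n =>
    integral_comp_eval (μ := fun _ : Fin N => ν) (hf n).1
  have hv := IndepFun.variance_sum (s := Finset.univ) (μ := μ)
    (X := fun n (ω : Fin N → Ω) => f n (ω n)) (fun n _ => hX n)
    (fun i _ j _ hij => hind.indepFun hij)
  have hS : MemLp (∑ n, fun ω : Fin N → Ω => f n (ω n)) 2 μ :=
    memLp_finsetSum' _ (fun n _ => hX n)
  rw [variance_eq_sub hS] at hv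
  have h1 : μ[∑ n, fun ω : Fin N → Ω => f n (ω n)] = ∑ n, ∫ p, f n p ∂ν := by
    simp only [Finset.sum_apply]
    rw [integral_finsetSum _ (fun n _ => (hX n).integrable (by norm_num))]
    simp [hE]
  rw [h1] at hv
  have h2 : ∫ ω, (∑ n, f n (ω n)) ^ 2 ∂μ = μ[(∑ n, fun ω : Fin N → Ω => f n (ω n)) ^ 2] := by
    simp
  rw [h2]
  have h3 : ∀ n, Var[fun ω : Fin N → Ω => f n (ω n); μ] ≤ ∫ ω, (f n (ω n)) ^ 2 ∂μ := by
    intro n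
    exact variance_le_expectation_sq (hX n).1
  have h4 := Finset.sum_le_sum (fun n (_ : n ∈ (Finset.univ : Finset (Fin N))) => h3 n)
  have h5 := sq_sum_le_card_mul_sum_sq (s := (Finset.univ : Finset (Fin N)))
    (f := fun n => ∫ p, f n p ∂ν)
  simp only [Finset.card_univ, Fintype.card_fin] at h5
  linarith

lemma measurable_sgn : Measurable sgn :=
  Measurable.ite measurableSet_Ici measurable_const measurable_const

lemma abs_sgn (s : ℝ) : |sgn s| ≤ 1 := by
  unfold sgn; split_ifs <;> simp

lemma ii_sgn (a b : ℝ) : IntervalIntegrable sgn volume a b := by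
  apply (intervalIntegrable_const (c := (1:ℝ))).mono_fun measurable_sgn.aestronglyMeasurable
  filter_upwards with s
  simpa using abs_sgn s

lemma int_sgn0 (b : ℝ) : ∫ t in (0:ℝ)..b, sgn t = |b| := by
  rcases le_total 0 b with h | h
  · rw [intervalIntegral.integral_congr (g := fun _ => (1:ℝ))]
    · simp [abs_of_nonneg h]
    · intro t ht
      rw [Set.uIcc_of_le h] at ht
      simp [sgn, ht.1]
  · rw [intervalIntegral.integral_symm, intervalIntegral.integral_congr_ae (g := fun _ => (-1:ℝ))]
    · simp [abs_of_nonpos h]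
    · have : ∀ᵐ t : ℝ, t ≠ 0 := by simp [ae_iff]
      filter_upwards [this] with t h0 ht
      rw [Set.uIoc_of_le h] at ht
      have : t < 0 := lt_of_le_of_ne ht.2 h0
      simp [sgn, not_le.mpr this]

lemma int_sgn (a b : ℝ) : ∫ t in a..b, sgn t = |b| - |a| := by
  rw [← int_sgn0, ← int_sgn0, intervalIntegral.integral_interval_sub_left (ii_sgn _ _) (ii_sgn _ _)]

lemma unif_prob {lam : ℝ} (h : 0 < lam) : IsProbabilityMeasure (unifIcc lam) := by
  constructor
  have h2 : (0:ℝ) < 2 * lam := by linarith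
  simp only [unifIcc, Measure.smul_apply, Measure.restrict_apply_univ, Real.volume_Icc]
  rw [show lam - -lam = 2 * lam by ring, ENNReal.smul_def, smul_eq_mul, ENNReal.ofReal,
    ← ENNReal.coe_mul, inv_mul_cancel₀ (by simpa using h), ENNReal.coe_one]

lemma int_unif {lam : ℝ} (h : 0 < lam) (y : ℝ) :
    lam * ∫ t, sgn (y + t) ∂(unifIcc lam) = (|y + lam| - |y - lam|) / 2 := by
  rw [unifIcc, integral_smul_nnreal_measure, integral_Icc_eq_integral_Ioc,
    ← intervalIntegral.integral_of_le (by linarith),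
    intervalIntegral.integral_comp_add_left (fun t => sgn t), int_sgn, NNReal.smul_def,
    NNReal.coe_inv, Real.coe_toNNReal _ (by linarith), smul_eq_mul, ← sub_eq_add_neg]
  field_simp

/-- The clipping error is exponentially small. -/
lemma clip_err {lam s : ℝ} (h : 0 < lam) (hs : 0 < s) (y : ℝ) :
    ((|y + lam| - |y - lam|) / 2 - y) ^ 2 ≤
      2 / s ^ 2 * Real.exp (-(s * lam)) * (Real.exp (s * y) + Real.exp (-(s * y))) := by
  have key : ∀ u : ℝ, 0 ≤ u → u ^ 2 ≤ 2 / s ^ 2 * Real.exp (s * u) := by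
    intro u hu
    have := Real.quadratic_le_exp_of_nonneg (x := s * u) (by positivity)
    have h0 : 0 ≤ s * u := by positivity
    rw [div_mul_eq_mul_div, le_div_iff₀ (by positivity)]
    nlinarith
  have hc : 0 < 2 / s ^ 2 := by positivity
  have e1 := Real.exp_pos (-(s * lam))
  have e2 := Real.exp_pos (s * y)
  have e3 := Real.exp_pos (-(s * y))
  have p1 : 0 < 2 / s ^ 2 * Real.exp (-(s * lam)) * Real.exp (s * y) := by positivity
  have p2 : 0 < 2 / s ^ 2 * Real.exp (-(s * lam)) * Real.exp (-(s * y)) := by positivity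
  rw [mul_add]
  rcases le_total y (-lam) with h1 | h1
  · have k := key (-lam - y) (by linarith)
    rw [show s * (-lam - y) = -(s * lam) + -(s * y) by ring, Real.exp_add] at k
    rw [abs_of_nonpos (by linarith), abs_of_nonpos (by linarith)]
    have : ((-(y + lam) - -(y - lam)) / 2 - y) = -lam - y := by ring
    rw [this]; nlinarith
  rcases le_total y lam with h2 | h2
  · rw [abs_of_nonneg (by linarith), abs_of_nonpos (by linarith)]
    have : ((y + lam - -(y - lam)) / 2 - y) = 0 := by ring
    rw [this]; nlinarith
  · have k := key (y - lam) (by linarith)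
    rw [show s * (y - lam) = -(s * lam) + s * y by ring, Real.exp_add] at k
    rw [abs_of_nonneg (by linarith), abs_of_nonneg (by linarith)]
    have : ((y + lam - (y - lam)) / 2 - y) = -(y - lam) := by ring
    rw [this]; nlinarith

lemma rad_int {d : ℕ} (g : (Fin d → Bool) → ℝ) :
    ∫ b, g b ∂(radMeasure d) = (2 ^ d : ℝ)⁻¹ * ∑ b, g b := by
  rw [radMeasure, PMF.integral_eq_sum, Finset.mul_sum]
  simp

lemma rad_mgf {d : ℕ} (a : Fin d → ℝ) :
    ∫ b, Real.exp (∑ l, a l * radVec b l) ∂(radMeasure d) ≤ Real.exp ((∑ l, a l ^ 2) / 2) := by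
  rw [rad_int]
  have h : ∑ b : Fin d → Bool, Real.exp (∑ l, a l * radVec b l) = ∏ l, (2 * Real.cosh (a l)) := by
    have := Finset.prod_univ_sum (fun _ : Fin d => (Finset.univ : Finset Bool))
      (fun l c => Real.exp (a l * (if c then 1 else -1)))
    simp only [Fintype.piFinset_univ] at this
    simp only [Real.exp_sum, radVec]
    rw [← this]
    refine Finset.prod_congr rfl fun l _ => ?_
    simp [Real.cosh_eq]
    ring
  rw [h, Finset.prod_mul_distrib]
  simp only [Finset.prod_const, Finset.card_univ, Fintype.card_fin]
  rw [← mul_assoc, inv_mul_cancel₀ (by positivity), one_mul, Finset.sum_div, Real.exp_sum]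
  exact Finset.prod_le_prod (fun l _ => (Real.cosh_pos _).le)
    fun l _ => Real.cosh_le_exp_half_sq _

lemma abs_radVec {d : ℕ} (b : Fin d → Bool) (i : Fin d) : |radVec b i| = 1 := by
  unfold radVec; split_ifs <;> simp

lemma radVec_sq {d : ℕ} (b : Fin d → Bool) (i : Fin d) : radVec b i * radVec b i = 1 := by
  unfold radVec; split_ifs <;> simp

lemma meas_L {d : ℕ} (H : Matrix (Fin d) (Fin d) ℝ) (lam : ℝ) (x : Fin d → ℝ) (i : Fin d) :
    Measurable (fun p : (Fin d → Bool) × (Fin d → ℝ) => Ltrans H p.1 lam p.2 x i) := by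
  have hr : ∀ l, Measurable (fun p : (Fin d → Bool) × (Fin d → ℝ) => radVec p.1 l) := fun l =>
    (measurable_of_finite (fun b : Fin d → Bool => radVec b l)).comp measurable_fst
  unfold Ltrans
  refine (hr i).mul (Finset.measurable_sum _ fun j _ => ?_)
  refine measurable_const.mul (measurable_const.mul (measurable_sgn.comp ?_))
  refine Measurable.add (Finset.measurable_sum _ fun l _ => ?_) ?_
  · exact measurable_const.mul ((hr l).mul measurable_const)
  · exact (measurable_pi_apply j).comp measurable_snd

lemma bound_L {d : ℕ} (H : Matrix (Fin d) (Fin d) ℝ) (lam : ℝ) (x : Fin d → ℝ) (i : Fin d)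
    (b : Fin d → Bool) (τ : Fin d → ℝ) : |Ltrans H b lam τ x i| ≤ ∑ j, |H j i| * |lam| := by
  unfold Ltrans
  rw [abs_mul, abs_radVec, one_mul]
  refine (Finset.abs_sum_le_sum_abs _ _).trans (Finset.sum_le_sum fun j _ => ?_)
  rw [abs_mul, abs_mul]
  refine mul_le_mul_of_nonneg_left ?_ (abs_nonneg _)
  exact mul_le_of_le_one_right (abs_nonneg _) (abs_sgn _)

lemma memLp_L {d : ℕ} (H : Matrix (Fin d) (Fin d) ℝ) (lam : ℝ) (x : Fin d → ℝ) (i : Fin d)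
    (ν : Measure ((Fin d → Bool) × (Fin d → ℝ))) [IsFiniteMeasure ν] :
    MemLp (fun p : (Fin d → Bool) × (Fin d → ℝ) => Ltrans H p.1 lam p.2 x i - x i) 2 ν := by
  refine MemLp.of_bound ((meas_L H lam x i).sub_const _).aestronglyMeasurable
    (∑ j, |H j i| * |lam| + |x i|) (Filter.Eventually.of_forall fun p => ?_)
  rw [Real.norm_eq_abs]
  exact (abs_sub _ _).trans (add_le_add_left (bound_L H lam x i _ _) _)

/-- Coordinates of `H_ε x`. -/
noncomputable def yv {d : ℕ} (H : Matrix (Fin d) (Fin d) ℝ) (b : Fin d → Bool)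
    (x : Fin d → ℝ) (j : Fin d) : ℝ := ∑ l : Fin d, H j l * (radVec b l * x l)

/-- The clipping error of the coordinate `y`. -/
noncomputable def cerr (lam y : ℝ) : ℝ := (|y + lam| - |y - lam|) / 2 - y

lemma inner_int {d : ℕ} (H : Matrix (Fin d) (Fin d) ℝ) (hH : Hᵀ * H = 1) {lam : ℝ}
    (h : 0 < lam) (x : Fin d → ℝ) (i : Fin d) (b : Fin d → Bool) :
    ∫ τ, (Ltrans H b lam τ x i - x i) ∂(Measure.pi fun _ : Fin d => unifIcc lam) =
      radVec b i * ∑ j, H j i * cerr lam (yv H b x j) := by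
  have := unif_prob h
  have hs : ∀ j : Fin d, Integrable (fun τ : Fin d → ℝ => sgn (yv H b x j + τ j))
      (Measure.pi fun _ : Fin d => unifIcc lam) := by
    intro j
    refine Integrable.of_bound (C := 1) (Measurable.aestronglyMeasurable ?_) ?_
    · exact measurable_sgn.comp (measurable_const.add (measurable_pi_apply j))
    · exact Filter.Eventually.of_forall fun τ => abs_sgn _
  have hi : ∀ j : Fin d, ∫ τ : Fin d → ℝ, sgn (yv H b x j + τ j)
      ∂(Measure.pi fun _ : Fin d => unifIcc lam) = ∫ t, sgn (yv H b x j + t) ∂(unifIcc lam) := by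
    intro j
    exact integral_comp_eval (μ := fun _ : Fin d => unifIcc lam) (i := j)
      (f := fun t => sgn (yv H b x j + t))
      (measurable_sgn.comp (measurable_const.add measurable_id)).aestronglyMeasurable
  have hx : ∑ j, H j i * yv H b x j = radVec b i * x i := by
    have : (Hᵀ *ᵥ (H *ᵥ (fun l => radVec b l * x l))) i = radVec b i * x i := by
      rw [Matrix.mulVec_mulVec, hH, Matrix.one_mulVec]
    rw [← this]; rfl
  have e1 : ∫ τ, Ltrans H b lam τ x i ∂(Measure.pi fun _ : Fin d => unifIcc lam) =
      radVec b i * ∑ j, H j i * (cerr lam (yv H b x j) + yv H b x j) := by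
    show ∫ τ, radVec b i * ∑ j : Fin d, H j i * (lam * sgn (yv H b x j + τ j))
      ∂(Measure.pi fun _ : Fin d => unifIcc lam) = _
    rw [integral_const_mul, integral_finsetSum _
      (fun j _ => ((hs j).const_mul lam).const_mul (H j i))]
    congr 1
    refine Finset.sum_congr rfl fun j _ => ?_
    rw [integral_const_mul, integral_const_mul, hi, int_unif h, cerr]
    ring
  rw [integral_sub, e1, integral_const]
  · simp only [mul_add, Finset.sum_add_distrib, hx]
    rw [← mul_assoc (radVec b i), radVec_sq]
    simp
  · refine Integrable.of_bound (C := ∑ j, |H j i| * |lam|) (Measurable.aestronglyMeasurable ?_) ?_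
    · exact (meas_L H lam x i).comp measurable_prodMk_left
    · exact Filter.Eventually.of_forall fun τ => bound_L _ _ _ _ _ _
  · exact integrable_const _

lemma sq_int_rad {d : ℕ} (g : (Fin d → Bool) → ℝ) :
    (∫ b, g b ∂(radMeasure d)) ^ 2 ≤ ∫ b, g b ^ 2 ∂(radMeasure d) := by
  have hg : MemLp g 2 (radMeasure d) := MemLp.of_discrete
  have h1 := variance_eq_sub hg
  have h2 := variance_nonneg g (radMeasure d)
  have h3 : (radMeasure d)[g ^ 2] = ∫ b, g b ^ 2 ∂(radMeasure d) := rfl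
  rw [h3] at h1
  linarith

lemma parseval {d : ℕ} (H : Matrix (Fin d) (Fin d) ℝ) (hH : Hᵀ * H = 1) (e : Fin d → ℝ) :
    ∑ i, (∑ j, H j i * e j) ^ 2 = ∑ j, e j ^ 2 := by
  have hH' : H * Hᵀ = 1 := mul_eq_one_comm.mp hH
  have : (Hᵀ *ᵥ e) ⬝ᵥ (Hᵀ *ᵥ e) = e ⬝ᵥ e := by
    rw [Matrix.dotProduct_mulVec, Matrix.vecMul_transpose, Matrix.mulVec_mulVec, hH',
      Matrix.one_mulVec]
  simp only [sq]
  exact this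

lemma bias_le {d : ℕ} (H : Matrix (Fin d) (Fin d) ℝ) (hH : Hᵀ * H = 1) {lam : ℝ}
    (h : 0 < lam) (x : Fin d → ℝ) :
    ∑ i, (∫ p : (Fin d → Bool) × (Fin d → ℝ), (Ltrans H p.1 lam p.2 x i - x i)
      ∂((radMeasure d).prod (Measure.pi fun _ : Fin d => unifIcc lam))) ^ 2 ≤
      ∑ j, ∫ b, cerr lam (yv H b x j) ^ 2 ∂(radMeasure d) := by
  have := unif_prob h
  rw [← integral_finsetSum _ (fun j _ => Integrable.of_finite)]
  have : ∀ b, ∑ j, cerr lam (yv H b x j) ^ 2 =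
      ∑ i, (radVec b i * ∑ j, H j i * cerr lam (yv H b x j)) ^ 2 := by
    intro b
    rw [← parseval H hH]
    refine Finset.sum_congr rfl fun i _ => ?_
    rw [mul_pow, sq (radVec b i), radVec_sq, one_mul]
  simp only [this]
  rw [integral_finsetSum _ (fun j _ => Integrable.of_finite)]
  refine Finset.sum_le_sum fun i _ => ?_
  rw [integral_prod _ ((memLp_L H lam x i _).integrable (by norm_num))]
  simp only [inner_int H hH h]
  exact sq_int_rad _

lemma cerr_int {d : ℕ} (hd : 0 < d) (H : Matrix (Fin d) (Fin d) ℝ)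
    (hF : ∀ k l : Fin d, |H k l| = 1 / Real.sqrt d) {lam s B : ℝ}
    (h : 0 < lam) (hs : 0 < s) (x : Fin d → ℝ) (hx : ∑ j, x j ^ 2 ≤ B ^ 2) (j : Fin d) :
    ∫ b, cerr lam (yv H b x j) ^ 2 ∂(radMeasure d) ≤
      2 / s ^ 2 * Real.exp (-(s * lam)) * (2 * Real.exp (s ^ 2 * (B ^ 2 / d) / 2)) := by
  have hd' : (0:ℝ) < d := by exact_mod_cast hd
  have hsq : ∀ l, H j l ^ 2 = 1 / d := by
    intro l
    rw [← sq_abs, hF, div_pow, Real.sq_sqrt hd'.le, one_pow]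
  have hm : ∀ c : ℝ, c ^ 2 = s ^ 2 → ∫ b, Real.exp (c * yv H b x j) ∂(radMeasure d) ≤
      Real.exp (s ^ 2 * (B ^ 2 / d) / 2) := by
    intro c hc
    have := rad_mgf (fun l => c * H j l * x l)
    have e : ∀ b, c * yv H b x j = ∑ l, c * H j l * x l * radVec b l := by
      intro b
      rw [yv, Finset.mul_sum]
      exact Finset.sum_congr rfl fun l _ => by ring
    simp only [e]
    refine this.trans (Real.exp_le_exp.mpr ?_)
    simp only [mul_pow, hsq, hc]
    rw [← Finset.mul_sum]
    have : s ^ 2 * (1 / (d:ℝ)) * ∑ l, x l ^ 2 ≤ s ^ 2 * (1 / (d:ℝ)) * B ^ 2 :=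
      mul_le_mul_of_nonneg_left hx (by positivity)
    have e2 : s ^ 2 * (B ^ 2 / (d:ℝ)) = s ^ 2 * (1 / (d:ℝ)) * B ^ 2 := by ring
    rw [e2]; linarith
  have h1 := hm s rfl
  have h2 := hm (-s) (by ring)
  calc _ ≤ ∫ b, 2 / s ^ 2 * Real.exp (-(s * lam)) *
        (Real.exp (s * yv H b x j) + Real.exp (-s * yv H b x j)) ∂(radMeasure d) := by
        refine integral_mono Integrable.of_finite Integrable.of_finite fun b => ?_
        have := clip_err h hs (yv H b x j)
        rw [← neg_mul s (yv H b x j)] at this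
        exact this
    _ ≤ _ := by
        rw [integral_const_mul, integral_add Integrable.of_finite Integrable.of_finite]
        refine mul_le_mul_of_nonneg_left (by linarith) (by positivity)

lemma bias_final {d : ℕ} (hd : 2 ≤ d) (H : Matrix (Fin d) (Fin d) ℝ) (hH : Hᵀ * H = 1)
    (hF : ∀ k l : Fin d, |H k l| = 1 / Real.sqrt d) {B α : ℝ} (hB : 0 < B) (hα : 2 ≤ α)
    {lam : ℝ} (hlam : lam = α * B * Real.sqrt (Real.log d / d)) (h : 0 < lam)
    (x : Fin d → ℝ) (hx : ∑ j, x j ^ 2 ≤ B ^ 2) :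
    ∑ i, (∫ p : (Fin d → Bool) × (Fin d → ℝ), (Ltrans H p.1 lam p.2 x i - x i)
      ∂((radMeasure d).prod (Measure.pi fun _ : Fin d => unifIcc lam))) ^ 2 ≤
      8 * B ^ 2 * Real.exp (-(1 / 8) * α ^ 2 * Real.log d) := by
  have hd' : (2:ℝ) ≤ d := by exact_mod_cast hd
  have hd0 : (0:ℝ) < d := by linarith
  have hlog : 1 / 2 ≤ Real.log d := by
    have := Real.log_two_gt_d9
    have := Real.log_le_log (by norm_num) hd'
    linarith
  have hl2 : lam ^ 2 = α ^ 2 * B ^ 2 * (Real.log d / d) := by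
    rw [hlam, mul_pow, mul_pow, Real.sq_sqrt (by positivity)]
  set s := lam * d / B ^ 2 with hs
  have hs0 : 0 < s := by positivity
  have hsl : s * lam = α ^ 2 * Real.log d := by
    rw [hs, show lam * d / B ^ 2 * lam = lam ^ 2 * d / B ^ 2 by ring, hl2]
    field_simp
  have hss : s ^ 2 * (B ^ 2 / d) = α ^ 2 * Real.log d := by
    rw [← hsl, hs]; field_simp
  have hs2 : s ^ 2 = α ^ 2 * Real.log d * d / B ^ 2 := by
    rw [← hss]; field_simp
  refine (bias_le H hH h x).trans ?_
  refine (Finset.sum_le_sum fun j _ => cerr_int (by omega) H hF h hs0 x hx j).trans ?_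
  rw [Finset.sum_const, Finset.card_univ, Fintype.card_fin, nsmul_eq_mul, hss, hsl, hs2]
  set A := α ^ 2 * Real.log d with hA
  have hA2 : 2 ≤ A := by nlinarith
  have e : (d:ℝ) * (2 / (A * d / B ^ 2) * Real.exp (-A) * (2 * Real.exp (A / 2))) =
      4 / A * B ^ 2 * Real.exp (-A / 2) := by
    rw [show -A / 2 = -A + A / 2 by ring, Real.exp_add]
    field_simp
    ring
  rw [e, show -(1 / 8) * α ^ 2 * Real.log d = -A / 8 by rw [hA]; ring]
  have h4 : 4 / A ≤ 8 := by
    rw [div_le_iff₀ (by linarith)]; linarith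
  have h5 : Real.exp (-A / 2) ≤ Real.exp (-A / 8) := Real.exp_le_exp.mpr (by linarith)
  gcongr

end AuxLemmas

/-- there is an absolute constant `C ≥ 2` such that for `N` independent copies
`L 1, …, L N` of the random `λ`-transform `Z_λ` (independent uniform sign pattern and dither
for each copy), with `λ = α·B·√(log d / d)`, `α ≥ C`, and any vectors `x n` of Euclidean norm
at most `B`: `E‖(1/N)Σ_n L n (x n) − (1/N)Σ_n x n‖² ≤ (1/N²)·Σ_n E‖L n (x n) − x n‖²
+ 8·N·B²·exp(−(1/8)·α²·log d)`. -/
theorem averaged_lambda_transform_error : ∃ C : ℝ, 2 ≤ C ∧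
    ∀ (d N : ℕ) (H : Matrix (Fin d) (Fin d) ℝ),
      Hᵀ * H = 1 → (∀ k l : Fin d, |H k l| = 1 / Real.sqrt d) →
      ∀ (B α : ℝ), 0 < B → C ≤ α →
      ∀ x : Fin N → Fin d → ℝ,
        (∀ n, Real.sqrt (∑ j : Fin d, (x n j) ^ 2) ≤ B) →
        (let lam := α * B * Real.sqrt (Real.log d / d)
         let μ : Measure (Fin N → (Fin d → Bool) × (Fin d → ℝ)) :=
           Measure.pi fun _ : Fin N =>
             (radMeasure d).prod (Measure.pi fun _ : Fin d => unifIcc lam)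
         (∫ ω, ∑ i : Fin d,
             (((N : ℝ)⁻¹ * ∑ n : Fin N, Ltrans H (ω n).1 lam (ω n).2 (x n) i) -
               (N : ℝ)⁻¹ * ∑ n : Fin N, x n i) ^ 2 ∂μ) ≤
           ((N : ℝ) ^ 2)⁻¹ *
             (∑ n : Fin N,
               ∫ ω, ∑ i : Fin d, (Ltrans H (ω n).1 lam (ω n).2 (x n) i - x n i) ^ 2 ∂μ) +
           8 * N * B ^ 2 * Real.exp (-(1 / 8) * α ^ 2 * Real.log d)) := by
  refine ⟨2, le_rfl, ?_⟩
  intro d N H hH hF B α hB hα x hx lam μ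
  have hexp := Real.exp_pos (-(1 / 8) * α ^ 2 * Real.log d)
  have hR : 0 ≤ 8 * (N:ℝ) * B ^ 2 * Real.exp (-(1 / 8) * α ^ 2 * Real.log d) := by positivity
  have hS : 0 ≤ ((N : ℝ) ^ 2)⁻¹ * (∑ n : Fin N,
      ∫ ω, ∑ i : Fin d, (Ltrans H (ω n).1 lam (ω n).2 (x n) i - x n i) ^ 2 ∂μ) := by
    refine mul_nonneg (by positivity) (Finset.sum_nonneg fun n _ => integral_nonneg fun ω => ?_)
    exact Finset.sum_nonneg fun i _ => sq_nonneg _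
  -- degenerate cases
  rcases Nat.eq_zero_or_pos N with hN | hN
  · have : ((N:ℝ))⁻¹ = 0 := by simp [hN]
    simp only [this, zero_mul, sub_self]
    simp only [ne_eq, OfNat.ofNat_ne_zero, not_false_eq_true, zero_pow, Finset.sum_const_zero,
      integral_zero]
    linarith
  rcases Nat.lt_or_ge d 2 with hd | hd
  · have hz : ∫ ω, ∑ i : Fin d,
             (((N : ℝ)⁻¹ * ∑ n : Fin N, Ltrans H (ω n).1 lam (ω n).2 (x n) i) -
               (N : ℝ)⁻¹ * ∑ n : Fin N, x n i) ^ 2 ∂μ = 0 := by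
      rcases Nat.eq_zero_or_pos d with h0 | h0
      · subst h0; simp
      · have h1 : d = 1 := by omega
        subst h1
        have hl : lam = 0 := by simp [lam]
        have hu : unifIcc lam = 0 := by simp [unifIcc, hl]
        have hμ : μ = 0 := by
          have : Nonempty (Fin N) := ⟨⟨0, hN⟩⟩
          rw [← Measure.measure_univ_eq_zero]
          simp only [μ, hu, Measure.pi_univ]
          refine Finset.prod_eq_zero (Finset.mem_univ ⟨0, hN⟩) ?_
          rw [← Set.univ_prod_univ, Measure.prod_prod, Measure.pi_univ]
          simp
        rw [hμ, integral_zero_measure]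
    rw [hz]; linarith
  -- main case
  have hd' : (2:ℝ) ≤ d := by exact_mod_cast hd
  have hN' : (0:ℝ) < N := by exact_mod_cast hN
  have hN1 : (1:ℝ) ≤ N := by exact_mod_cast hN
  have hlogp : 0 < Real.log d := Real.log_pos (by linarith)
  have hlam : 0 < lam := by
    have : 0 < Real.sqrt (Real.log d / d) := Real.sqrt_pos.mpr (by positivity)
    have : 0 < α := by linarith
    positivity
  have := unif_prob hlam
  have hx2 : ∀ n, ∑ j, x n j ^ 2 ≤ B ^ 2 := by
    intro n
    have h0 : 0 ≤ ∑ j, x n j ^ 2 := Finset.sum_nonneg fun j _ => sq_nonneg _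
    exact (Real.sqrt_le_left hB.le).mp (hx n)
  set ν : Measure ((Fin d → Bool) × (Fin d → ℝ)) :=
    (radMeasure d).prod (Measure.pi fun _ : Fin d => unifIcc lam) with hν
  let f : Fin d → Fin N → (Fin d → Bool) × (Fin d → ℝ) → ℝ :=
    fun i n p => Ltrans H p.1 lam p.2 (x n) i - x n i
  have hf : ∀ i n, MemLp (f i n) 2 ν := fun i n => memLp_L H lam (x n) i ν
  have hX : ∀ i n, MemLp (fun ω : Fin N → (Fin d → Bool) × (Fin d → ℝ) => f i n (ω n)) 2 μ :=
    fun i n => (hf i n).comp_measurePreserving (measurePreserving_eval _ n)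
  have hXi : ∀ i n, Integrable
      (fun ω : Fin N → (Fin d → Bool) × (Fin d → ℝ) => f i n (ω n) ^ 2) μ :=
    fun i n => (hX i n).integrable_sq
  have hSi : ∀ i, Integrable
      (fun ω : Fin N → (Fin d → Bool) × (Fin d → ℝ) => (∑ n, f i n (ω n)) ^ 2) μ :=
    fun i => (memLp_finsetSum _ (fun n _ => hX i n)).integrable_sq
  have hL : ∫ ω, ∑ i : Fin d,
      (((N : ℝ)⁻¹ * ∑ n : Fin N, Ltrans H (ω n).1 lam (ω n).2 (x n) i) -
        (N : ℝ)⁻¹ * ∑ n : Fin N, x n i) ^ 2 ∂μ =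
      ((N : ℝ) ^ 2)⁻¹ * ∑ i, ∫ ω, (∑ n, f i n (ω n)) ^ 2 ∂μ := by
    rw [← integral_finsetSum _ (fun i _ => hSi i), ← integral_const_mul]
    congr 1
    funext ω
    rw [Finset.mul_sum]
    refine Finset.sum_congr rfl fun i _ => ?_
    simp only [f, Finset.sum_sub_distrib]
    rw [← mul_sub, mul_pow, inv_pow]
  have hRR : ∑ n : Fin N,
      ∫ ω, ∑ i : Fin d, (Ltrans H (ω n).1 lam (ω n).2 (x n) i - x n i) ^ 2 ∂μ =
      ∑ i, ∑ n, ∫ ω, f i n (ω n) ^ 2 ∂μ := by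
    rw [Finset.sum_comm]
    refine Finset.sum_congr rfl fun n _ => ?_
    exact integral_finsetSum _ (fun i _ => hXi i n)
  rw [hL, hRR]
  have hmain : ∑ i, ∫ ω, (∑ n, f i n (ω n)) ^ 2 ∂μ ≤
      ∑ i, ∑ n, ∫ ω, f i n (ω n) ^ 2 ∂μ + N * ∑ n, ∑ i, (∫ p, f i n p ∂ν) ^ 2 := by
    rw [Finset.sum_comm (f := fun n i => (∫ p, f i n p ∂ν) ^ 2), Finset.mul_sum,
      ← Finset.sum_add_distrib]
    exact Finset.sum_le_sum fun i _ => aux_sum ν (f i) (hf i)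
  have hb : ∑ n, ∑ i, (∫ p, f i n p ∂ν) ^ 2 ≤
      N * (8 * B ^ 2 * Real.exp (-(1 / 8) * α ^ 2 * Real.log d)) := by
    refine (Finset.sum_le_sum fun n _ =>
      bias_final hd H hH hF hB hα (lam := lam) rfl hlam (x n) (hx2 n)).trans ?_
    simp
  set E := Real.exp (-(1 / 8) * α ^ 2 * Real.log d)
  calc _ ≤ ((N : ℝ) ^ 2)⁻¹ * (∑ i, ∑ n, ∫ ω, f i n (ω n) ^ 2 ∂μ +
        N * (N * (8 * B ^ 2 * E))) := by
        refine mul_le_mul_of_nonneg_left (hmain.trans ?_) (by positivity)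
        gcongr
    _ = ((N : ℝ) ^ 2)⁻¹ * (∑ i, ∑ n, ∫ ω, f i n (ω n) ^ 2 ∂μ) + 1 * (8 * B ^ 2 * E) := by
        field_simp
    _ ≤ ((N : ℝ) ^ 2)⁻¹ * (∑ i, ∑ n, ∫ ω, f i n (ω n) ^ 2 ∂μ) + N * (8 * B ^ 2 * E) := by
        gcongr
    _ = _ := by ring
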